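/- Let Σ be a finite subset of ℕ* with |Σ| < q, let w be a positive integer, and let 𝙰 be an admissible array with pairwise disjoint ordinary finite types which is a composition of (Σ, w). Then there exist finitely many elements α'_1,…,α'_m ∈ F_q and admissible arrays 𝙱'_1,…,𝙱'_m with pairwise disjoint ordinary finite types, each a composition of (Σ, w), all independent of d, such that for all d ∈ ℕ: S_d†(𝙰) = Σ_{i=1}^{m} α'_i S_d(𝙱'_i). -/

import Mathlib

/-!
STATEMENT 15: Let `Σ` be a finite subset of `ℕ*` with `|Σ| < q`, `w ≥ 1`, and
let `𝙰` be an admissible array with pairwise disjoint ordinary finite types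
which is a composition of `(Σ, w)`.  Then there exist finitely many
`α′_1,…,α′_m ∈ F_q` and admissible arrays `𝙱′_1,…,𝙱′_m` with pairwise disjoint
ordinary finite types, each a composition of `(Σ, w)`, all independent of `d`,
such that for all `d ∈ ℕ`: `S_d†(𝙰) = Σ_i α′_i S_d(𝙱′_i)` in the polynomial
ring over `K = F_q(θ)` in the indeterminates `t_n`.
-/

open Polynomial Finset

noncomputable section

variable (Fq : Type) [Field Fq] [Fintype Fq]

/-- `q`, the cardinality of the base field. -/
abbrev q := Fintype.card Fq

/-- `θ` as an element of `K = F_q(θ)`. -/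
def th : RatFunc Fq := algebraMap (Polynomial Fq) (RatFunc Fq) Polynomial.X

/-- `a` as an element of `K`. -/
def aK (a : Polynomial Fq) : RatFunc Fq := algebraMap (Polynomial Fq) (RatFunc Fq) a

/-- The canonical map `F_q → K`. -/
def FqK : Fq →+* RatFunc Fq :=
  (algebraMap (Polynomial Fq) (RatFunc Fq)).comp Polynomial.C

/-- The monic polynomial `θ^d + Σ_{i<d} c_i θ^i`; as `c` ranges over `Fin d → Fq`
these are exactly the elements of `A^+(d)`. -/
def mP (d : ℕ) (c : Fin d → Fq) : Polynomial Fq :=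
  Polynomial.X ^ d + ∑ i : Fin d, Polynomial.C (c i) * Polynomial.X ^ (i : ℕ)

/-- `a(t_i)`: substitute `θ` by the indeterminate `t_i` in `a ∈ A`. -/
def tval (i : ℕ+) (a : Polynomial Fq) : MvPolynomial ℕ+ (RatFunc Fq) :=
  Polynomial.eval₂ ((MvPolynomial.C : RatFunc Fq →+* MvPolynomial ℕ+ (RatFunc Fq)).comp (FqK Fq))
    (MvPolynomial.X i) a

/-- The scalar power sum `S_d(s) = Σ_{a∈A^+(d)} a^{−s} ∈ K`. -/
def Ssc (d : ℕ) (s : ℕ) : RatFunc Fq := ∑ c : Fin d → Fq, ((aK Fq (mP Fq d c)) ^ s)⁻¹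

/-- `b_d(t_i) = ∏_{m<d} (t_i − θ^{q^m})` as a polynomial in the variable `t_i`. -/
def bMv (d : ℕ) (i : ℕ+) : MvPolynomial ℕ+ (RatFunc Fq) :=
  ∏ m ∈ Finset.range d, (MvPolynomial.X i - MvPolynomial.C (th Fq ^ q Fq ^ m))

/-- The depth-one power sum `S_d(Σ; s) = Σ_{a∈A^+(d)} χ_Σ(a)/a^s`, where
`χ_Σ(a) = ∏_{i∈Σ} a(t_i)` for an ordinary finite subset `Σ` of `ℕ*`. -/
def S1F (d : ℕ) (Sg : Finset ℕ+) (s : ℕ) : MvPolynomial ℕ+ (RatFunc Fq) :=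
  ∑ c : Fin d → Fq, (∏ i ∈ Sg, tval Fq i (mP Fq d c)) *
    MvPolynomial.C ((aK Fq (mP Fq d c)) ^ s)⁻¹

/-- The depth-one dagger power sum `S_d†(Σ; s) = S_d(s)·b_d(Σ)`, with
`b_d(Σ) = ∏_{i∈Σ} b_d(t_i)`. -/
def S1D (d : ℕ) (Sg : Finset ℕ+) (s : ℕ) : MvPolynomial ℕ+ (RatFunc Fq) :=
  MvPolynomial.C (Ssc Fq d s) * ∏ i ∈ Sg, bMv Fq d i

/-- Power sums of arrays with ordinary finite types (lists of pairs `(Σ_i, s_i)`):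
`S_d(𝙰) = Σ_{d = d_1 > … > d_r ≥ 0} ∏_i S_{d_i}(Σ_i; s_i)`. -/
def SPF : List (Finset ℕ+ × ℕ) → ℕ → MvPolynomial ℕ+ (RatFunc Fq)
  | [], d => if d = 0 then 1 else 0
  | [x], d => S1F Fq d x.1 x.2
  | x :: y :: L, d => S1F Fq d x.1 x.2 * ∑ k ∈ Finset.range d, SPF (y :: L) k

/-- Dagger power sums of arrays with ordinary finite types:
`S_d†(𝙰) = Σ_{d = d_1 > … > d_r ≥ 0} ∏_i S_{d_i}(s_i) b_{d_i}(Σ_i)`. -/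
def SPD : List (Finset ℕ+ × ℕ) → ℕ → MvPolynomial ℕ+ (RatFunc Fq)
  | [], d => if d = 0 then 1 else 0
  | [x], d => S1D Fq d x.1 x.2
  | x :: y :: L, d => S1D Fq d x.1 x.2 * ∑ k ∈ Finset.range d, SPD (y :: L) k

/-- `𝙰` is an admissible array (with pairwise disjoint ordinary finite types)
which is a composition of `(Σ, w)`: all exponents are positive, the types are
pairwise disjoint with union `Σ`, and the exponents add up to `w`. -/
def IsCompF (L : List (Finset ℕ+ × ℕ)) (Sg : Finset ℕ+) (w : ℕ) : Prop :=
  (∀ x ∈ L, 1 ≤ x.2) ∧ L.Pairwise (fun x y => Disjoint x.1 y.1) ∧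
    (L.map Prod.fst).foldr (· ∪ ·) ∅ = Sg ∧ (L.map Prod.snd).sum = w


set_option linter.unusedSectionVars false

/-- The ring in which all power sums live. -/
abbrev PowRing := MvPolynomial ℕ+ (RatFunc Fq)

/-- The polynomial `Σ_{i<d} c_i θ^i`. -/
def lowPoly (d : ℕ) (c : Fin d → Fq) : Polynomial Fq :=
  ∑ i : Fin d, Polynomial.C (c i) * Polynomial.X ^ (i : ℕ)

/-- `SPF L` summed over all degrees below `d`, with value `1` on the empty array. -/
def SPFlt (L : List (Finset ℕ+ × ℕ)) (d : ℕ) : PowRing Fq :=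
  match L with
  | [] => 1
  | x :: L => ∑ k ∈ Finset.range d, SPF Fq (x :: L) k

/-- The span of the power sums of compositions of `(Σ, w)`. -/
def spanS (Sg : Finset ℕ+) (w : ℕ) : Submodule Fq (ℕ → PowRing Fq) :=
  Submodule.span Fq (SPF Fq '' {B | IsCompF B Sg w})

/-- The span of the sums `SPFlt` of compositions of `(Σ, w)`. -/
def spanLt (Sg : Finset ℕ+) (w : ℕ) : Submodule Fq (ℕ → PowRing Fq) :=
  Submodule.span Fq (SPFlt Fq '' {B | IsCompF B Sg w})

/-- The span of the power sums of depth-two compositions of `(Σ, w)`. -/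
def spanTwo (Sg : Finset ℕ+) (w : ℕ) : Submodule Fq (ℕ → PowRing Fq) :=
  Submodule.span Fq {f | ∃ (J I : Finset ℕ+) (i j : ℕ), 1 ≤ i ∧ 1 ≤ j ∧ i + j = w ∧
    Disjoint J I ∧ J ∪ I = Sg ∧ f = fun d => S1F Fq d J i * SPFlt Fq [(I, j)] d}

/-- The sum over pairs of monic polynomials `a, b` of degree `d` of
`χ_{Σ₁}(a) χ_{Σ₂}(b) / (a^r b^s (a - b)^j)`, where division by zero gives zero. -/
def pairSum (S₁ S₂ : Finset ℕ+) (r s j d : ℕ) : PowRing Fq :=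
  ∑ c : Fin d → Fq, ∑ c' : Fin d → Fq,
    (∏ i ∈ S₁, tval Fq i (mP Fq d c)) * (∏ i ∈ S₂, tval Fq i (mP Fq d c')) *
      MvPolynomial.C (((aK Fq (mP Fq d c)) ^ r)⁻¹ * ((aK Fq (mP Fq d c')) ^ s)⁻¹ *
        ((aK Fq (mP Fq d c) - aK Fq (mP Fq d c')) ^ j)⁻¹)

/-! ### Compositions -/

section Compositions

lemma IsCompF.cons {L : List (Finset ℕ+ × ℕ)} {S₁ S₂ : Finset ℕ+} {s w : ℕ}
    (hL : IsCompF L S₂ w) (hd : Disjoint S₁ S₂) (hs : 1 ≤ s) :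
    IsCompF ((S₁, s) :: L) (S₁ ∪ S₂) (s + w) := by
  obtain ⟨h1, h2, h3, h4⟩ := hL
  refine ⟨by simpa using ⟨hs, by simpa using h1⟩, List.pairwise_cons.2 ⟨?_, h2⟩, by simp [← h3],
    by simp [← h4]⟩
  intro y hy
  refine hd.mono_right ?_
  rw [← h3]
  clear h1 h2 h3 h4
  induction L with
  | nil => simp at hy
  | cons z L ih =>
    rcases List.mem_cons.1 hy with rfl | hy
    · exact Finset.subset_union_left
    · exact (ih hy).trans Finset.subset_union_right

lemma IsCompF.of_cons {L : List (Finset ℕ+ × ℕ)} {x : Finset ℕ+ × ℕ} {Sg : Finset ℕ+} {w : ℕ}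
    (h : IsCompF (x :: L) Sg w) :
    ∃ S' w', IsCompF L S' w' ∧ Disjoint x.1 S' ∧ 1 ≤ x.2 ∧ x.1 ∪ S' = Sg ∧ x.2 + w' = w := by
  obtain ⟨h1, h2, h3, h4⟩ := h
  rw [List.pairwise_cons] at h2
  refine ⟨_, _, ⟨fun y hy => h1 y (List.mem_cons_of_mem _ hy), h2.2, rfl, rfl⟩, ?_,
    h1 x List.mem_cons_self, by simpa using h3, by simpa using h4⟩
  have h2' := h2.1
  clear h1 h2 h3 h4
  induction L with
  | nil => simp
  | cons z L ih =>
    simp only [List.map_cons, List.foldr_cons]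
    rw [Finset.disjoint_union_right]
    exact ⟨h2' z List.mem_cons_self, ih fun y hy => h2' y (List.mem_cons_of_mem _ hy)⟩

lemma isCompF_nil_iff {Sg : Finset ℕ+} {w : ℕ} : IsCompF [] Sg w ↔ Sg = ∅ ∧ w = 0 := by
  simp [IsCompF, eq_comm]

lemma isCompF_nil : IsCompF [] ∅ 0 := isCompF_nil_iff.2 ⟨rfl, rfl⟩

end Compositions

/-! ### Basic facts on power sums -/

lemma SPF_cons (x : Finset ℕ+ × ℕ) (L : List (Finset ℕ+ × ℕ)) (d : ℕ) :
    SPF Fq (x :: L) d = S1F Fq d x.1 x.2 * SPFlt Fq L d := by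
  cases L <;> simp [SPF, SPFlt]

lemma smul_powRing (α : Fq) (f : PowRing Fq) : α • f = MvPolynomial.C (FqK Fq α) * f := by
  rw [Algebra.smul_def]; rfl

lemma tval_C_mul (i : ℕ+) (α : Fq) (a : Polynomial Fq) :
    tval Fq i (Polynomial.C α * a) = α • tval Fq i a := by
  rw [smul_powRing]; simp [tval]

lemma tval_add (i : ℕ+) (a b : Polynomial Fq) :
    tval Fq i (a + b) = tval Fq i a + tval Fq i b := by
  simp [tval]

lemma mP_eq (d : ℕ) (c : Fin d → Fq) : mP Fq d c = X ^ d + lowPoly Fq d c := rfl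

lemma lowPoly_snoc (d : ℕ) (c : Fin d → Fq) (l : Fq) :
    lowPoly Fq (d + 1) (Fin.snoc c l : Fin (d + 1) → Fq) = lowPoly Fq d c + C l * X ^ d := by
  simp [lowPoly, Fin.sum_univ_castSucc]

lemma lowPoly_smul (d : ℕ) (c : Fin d → Fq) (l : Fq) :
    lowPoly Fq d (l • c) = C l * lowPoly Fq d c := by
  simp [lowPoly, Finset.mul_sum, mul_assoc]

lemma mP_sub (d : ℕ) (c e : Fin d → Fq) :
    mP Fq d (c - e) = mP Fq d c - lowPoly Fq d e := by
  simp only [mP_eq, lowPoly, Pi.sub_apply, C_sub, sub_mul, Finset.sum_sub_distrib]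
  ring

lemma lowPoly_degree_lt (d : ℕ) (c : Fin d → Fq) : (lowPoly Fq d c).degree < d := by
  refine (Polynomial.degree_sum_le _ _).trans_lt ?_
  refine (Finset.sup_lt_iff (WithBot.bot_lt_coe d)).2 fun i _ => ?_
  exact (Polynomial.degree_C_mul_X_pow_le _ _).trans_lt (Nat.cast_lt.2 i.2)

lemma mP_monic (d : ℕ) (c : Fin d → Fq) : (mP Fq d c).Monic :=
  Polynomial.monic_X_pow_add (lowPoly_degree_lt Fq d c)

lemma aK_mP_ne_zero (d : ℕ) (c : Fin d → Fq) : aK Fq (mP Fq d c) ≠ 0 := by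
  simpa [aK] using (mP_monic Fq d c).ne_zero

lemma lowPoly_injective (d : ℕ) : Function.Injective (lowPoly Fq d) := by
  intro c e h
  funext i
  have := congrArg (fun p => p.coeff i) h
  simpa [lowPoly, Polynomial.finsetSum_coeff, Polynomial.coeff_X_pow, Fin.ext_iff.symm,
    Finset.sum_ite_eq] using this

lemma aK_mP_injective (d : ℕ) : Function.Injective fun c => aK Fq (mP Fq d c) := by
  intro c e h
  have h' : mP Fq d c = mP Fq d e := RatFunc.algebraMap_injective Fq h
  exact lowPoly_injective Fq d (add_left_cancel h')

/-- Polynomials of degree `< d` are `0` or uniquely a unit times a monic polynomial. -/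
lemma sum_lowPoly [DecidableEq Fq] {M : Type*} [AddCommMonoid M] (G : Polynomial Fq → M) (d : ℕ) :
    ∑ c : Fin d → Fq, G (lowPoly Fq d c) =
      G 0 + ∑ k ∈ Finset.range d, ∑ l : Fqˣ, ∑ c : Fin k → Fq, G (C (l : Fq) * mP Fq k c) := by
  induction d with
  | zero => simp [lowPoly]
  | succ d ih =>
    rw [Finset.sum_range_succ, ← add_assoc, ← ih,
      ← (Fin.snocEquiv fun _ : Fin (d + 1) => Fq).sum_comp, Fintype.sum_prod_type]
    simp only [Fin.snocEquiv, Equiv.coe_fn_mk]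
    simp_rw [lowPoly_snoc]
    rw [Fintype.sum_eq_add_sum_compl (0 : Fq)]
    congr 1
    · simp
    · refine Finset.sum_bij' (fun l hl => Units.mk0 l (by simpa using hl)) (fun l _ => (l : Fq))
        (by simp) (by simp) (by simp) (by simp) ?_
      intro l hl
      have hl0 : l ≠ 0 := by simpa using hl
      rw [← Equiv.sum_comp (MulAction.toPerm (Units.mk0 l hl0) : Equiv.Perm (Fin d → Fq))]
      refine Finset.sum_congr rfl fun c _ => ?_
      have : lowPoly Fq d ((Units.mk0 l hl0) • c) = C l * lowPoly Fq d c := lowPoly_smul Fq d c l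
      rw [MulAction.toPerm_apply, this, Units.val_mk0, mP_eq, mul_add, add_comm]

/-! ### Product of two depth-one power sums -/

lemma prod_tval_sub_mul_inv (S : Finset ℕ+) (j : ℕ) (a f : Polynomial Fq) (l : Fqˣ) :
    (∏ i ∈ S, tval Fq i (a - C (l : Fq) * f)) *
      MvPolynomial.C ((aK Fq a - aK Fq (a - C (l : Fq) * f)) ^ j)⁻¹ =
    ∑ I ∈ S.powerset, ((-(l : Fq)) ^ I.card * ((l : Fq) ^ j)⁻¹) •
      ((∏ i ∈ S \ I, tval Fq i a) *
        ((∏ i ∈ I, tval Fq i f) * MvPolynomial.C (aK Fq f ^ j)⁻¹)) := by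
  have h1 : ∀ i, tval Fq i (a - C (l : Fq) * f) = (-(l : Fq)) • tval Fq i f + tval Fq i a := by
    intro i
    rw [← tval_C_mul, ← tval_add]
    congr 1
    rw [C_neg]; ring
  have h2 : MvPolynomial.C ((aK Fq a - aK Fq (a - C (l : Fq) * f)) ^ j)⁻¹
      = ((l : Fq) ^ j)⁻¹ • (MvPolynomial.C (aK Fq f ^ j)⁻¹ : PowRing Fq) := by
    rw [smul_powRing, ← map_mul]
    congr 1
    simp [aK, FqK, mul_pow, mul_comm]
  simp_rw [h1, h2, Finset.prod_add, Finset.sum_mul]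
  refine Finset.sum_congr rfl fun I _ => ?_
  rw [← Finset.smul_prod]
  simp only [smul_mul_assoc, mul_smul_comm, smul_smul]
  congr 1
  · ring
  · ring

lemma sum_prod_tval_mul_inv [DecidableEq Fq] (S : Finset ℕ+) (j : ℕ) (hj : 1 ≤ j) (d : ℕ)
    (c : Fin d → Fq) :
    ∑ c' : Fin d → Fq, (∏ i ∈ S, tval Fq i (mP Fq d c')) *
      MvPolynomial.C ((aK Fq (mP Fq d c) - aK Fq (mP Fq d c')) ^ j)⁻¹ =
    ∑ I ∈ S.powerset, (∑ l : Fqˣ, (-(l : Fq)) ^ I.card * ((l : Fq) ^ j)⁻¹) •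
      ((∏ i ∈ S \ I, tval Fq i (mP Fq d c)) * SPFlt Fq [(I, j)] d) := by
  rw [← (Equiv.subLeft c).sum_comp]
  simp only [Equiv.subLeft_apply, mP_sub]
  rw [sum_lowPoly Fq (fun g => (∏ i ∈ S, tval Fq i (mP Fq d c - g)) *
    MvPolynomial.C ((aK Fq (mP Fq d c) - aK Fq (mP Fq d c - g)) ^ j)⁻¹)]
  simp only [prod_tval_sub_mul_inv, sub_zero, sub_self, zero_pow (Nat.one_le_iff_ne_zero.1 hj),
    inv_zero, map_zero, mul_zero, zero_add]
  have hfac : ∀ (k : ℕ) (l : Fqˣ),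
      ∑ e : Fin k → Fq, ∑ I ∈ S.powerset, ((-(l : Fq)) ^ I.card * ((l : Fq) ^ j)⁻¹) •
        ((∏ i ∈ S \ I, tval Fq i (mP Fq d c)) * ((∏ i ∈ I, tval Fq i (mP Fq k e)) *
          MvPolynomial.C (aK Fq (mP Fq k e) ^ j)⁻¹)) =
      ∑ I ∈ S.powerset, ((-(l : Fq)) ^ I.card * ((l : Fq) ^ j)⁻¹) •
        ((∏ i ∈ S \ I, tval Fq i (mP Fq d c)) * S1F Fq k I j) := by
    intro k l
    rw [Finset.sum_comm]
    refine Finset.sum_congr rfl fun I _ => ?_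
    rw [← Finset.smul_sum, ← Finset.mul_sum, S1F]
  simp_rw [hfac]
  calc _ = ∑ k ∈ Finset.range d, ∑ I ∈ S.powerset,
        (∑ l : Fqˣ, (-(l : Fq)) ^ I.card * ((l : Fq) ^ j)⁻¹) •
          ((∏ i ∈ S \ I, tval Fq i (mP Fq d c)) * S1F Fq k I j) := by
        refine Finset.sum_congr rfl fun k _ => ?_
        rw [Finset.sum_comm]
        exact Finset.sum_congr rfl fun I _ => (Finset.sum_smul).symm
    _ = _ := by
        rw [Finset.sum_comm]
        refine Finset.sum_congr rfl fun I _ => ?_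
        rw [← Finset.smul_sum, ← Finset.mul_sum]
        rfl

lemma pairSum_zero_eq [DecidableEq Fq] (S₁ S₂ : Finset ℕ+) (h : Disjoint S₁ S₂) (r j : ℕ)
    (hj : 1 ≤ j) :
    pairSum Fq S₁ S₂ r 0 j = ∑ I ∈ S₂.powerset,
      (∑ l : Fqˣ, (-(l : Fq)) ^ I.card * ((l : Fq) ^ j)⁻¹) •
        (fun d => S1F Fq d (S₁ ∪ (S₂ \ I)) r * SPFlt Fq [(I, j)] d) := by
  funext d
  simp only [pairSum, Finset.sum_apply, Pi.smul_apply, pow_zero, inv_one, mul_one]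
  have hc : ∀ c : Fin d → Fq, ∑ c' : Fin d → Fq,
      (∏ i ∈ S₁, tval Fq i (mP Fq d c)) * (∏ i ∈ S₂, tval Fq i (mP Fq d c')) *
        MvPolynomial.C ((aK Fq (mP Fq d c) ^ r)⁻¹ *
          ((aK Fq (mP Fq d c) - aK Fq (mP Fq d c')) ^ j)⁻¹) =
      (∏ i ∈ S₁, tval Fq i (mP Fq d c)) * MvPolynomial.C (aK Fq (mP Fq d c) ^ r)⁻¹ *
        ∑ c' : Fin d → Fq, ((∏ i ∈ S₂, tval Fq i (mP Fq d c')) *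
          MvPolynomial.C ((aK Fq (mP Fq d c) - aK Fq (mP Fq d c')) ^ j)⁻¹) := by
    intro c
    rw [Finset.mul_sum]
    refine Finset.sum_congr rfl fun c' _ => ?_
    rw [map_mul, mul_mul_mul_comm]
  simp_rw [hc, sum_prod_tval_mul_inv Fq S₂ j hj, Finset.mul_sum]
  rw [Finset.sum_comm]
  refine Finset.sum_congr rfl fun I hI => ?_
  rw [S1F, Finset.sum_mul, Finset.smul_sum]
  refine Finset.sum_congr rfl fun c _ => ?_
  rw [Finset.prod_union (h.mono_right Finset.sdiff_subset), mul_smul_comm]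
  congr 1
  ring

lemma pairSum_zero_mem (S₁ S₂ : Finset ℕ+) (h : Disjoint S₁ S₂) (r j : ℕ) (hr : 1 ≤ r)
    (hj : 1 ≤ j) : pairSum Fq S₁ S₂ r 0 j ∈ spanTwo Fq (S₁ ∪ S₂) (r + j) := by
  classical
  rw [pairSum_zero_eq Fq S₁ S₂ h r j hj]
  refine Submodule.sum_mem _ fun I hI => Submodule.smul_mem _ _ (Submodule.subset_span ?_)
  rw [Finset.mem_powerset] at hI
  refine ⟨_, _, r, j, hr, hj, rfl, ?_, ?_, rfl⟩
  · rw [Finset.disjoint_union_left]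
    exact ⟨h.mono_right hI, Finset.sdiff_disjoint⟩
  · rw [Finset.union_assoc, Finset.sdiff_union_of_subset hI]

lemma pairSum_swap (S₁ S₂ : Finset ℕ+) (r s j : ℕ) :
    pairSum Fq S₁ S₂ r s j = ((-1 : Fq) ^ j) • pairSum Fq S₂ S₁ s r j := by
  funext d
  simp only [pairSum, Pi.smul_apply]
  rw [Finset.sum_comm, Finset.smul_sum]
  refine Finset.sum_congr rfl fun c _ => ?_
  rw [Finset.smul_sum]
  refine Finset.sum_congr rfl fun c' _ => ?_
  rw [smul_powRing, ← neg_sub (aK Fq (mP Fq d c)), neg_pow, mul_inv]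
  have : (((-1 : RatFunc Fq) ^ j)⁻¹) = FqK Fq ((-1) ^ j) := by
    rw [map_pow, map_neg, map_one, ← inv_pow, inv_neg, inv_one]
  rw [this]
  simp only [map_mul]
  ring

lemma pairSum_mem (S₁ S₂ : Finset ℕ+) (h : Disjoint S₁ S₂) (r s j : ℕ) (hrs : 1 ≤ r + s)
    (hj : 1 ≤ j) : pairSum Fq S₁ S₂ r s j ∈ spanTwo Fq (S₁ ∪ S₂) (r + s + j) := by
  induction hn : r + s using Nat.strong_induction_on generalizing r s j with
  | _ n ih =>
    subst hn
    rcases s with _ | s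
    · exact pairSum_zero_mem Fq S₁ S₂ h r j hrs hj
    rcases r with _ | r
    · rw [pairSum_swap, Finset.union_comm, zero_add]
      exact Submodule.smul_mem _ _ (pairSum_zero_mem Fq S₂ S₁ h.symm _ j (by omega) hj)
    have key : pairSum Fq S₁ S₂ (r + 1) (s + 1) j =
        pairSum Fq S₁ S₂ r (s + 1) (j + 1) - pairSum Fq S₁ S₂ (r + 1) s (j + 1) := by
      funext d
      simp only [pairSum, Pi.sub_apply, ← Finset.sum_sub_distrib]
      refine Finset.sum_congr rfl fun c _ => Finset.sum_congr rfl fun c' _ => ?_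
      rw [← mul_sub, ← map_sub]
      congr 2
      have ha := aK_mP_ne_zero Fq d c
      have hb := aK_mP_ne_zero Fq d c'
      rcases eq_or_ne (aK Fq (mP Fq d c) - aK Fq (mP Fq d c')) 0 with h0 | h0
      · rw [h0]; simp [Nat.one_le_iff_ne_zero.1 hj]
      · field_simp
        ring
    rw [key]
    refine Submodule.sub_mem _ ?_ ?_
    · convert ih (r + (s + 1)) (by omega) r (s + 1) (j + 1) (by omega) (by omega) rfl using 2
      omega
    · convert ih (r + 1 + s) (by omega) (r + 1) s (j + 1) (by omega) (by omega) rfl using 2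
      omega

lemma S1F_mul_S1F (S₁ S₂ : Finset ℕ+) (h : Disjoint S₁ S₂) (r s : ℕ) (hr : 1 ≤ r) (hs : 1 ≤ s) :
    (fun d => S1F Fq d S₁ r * S1F Fq d S₂ s - S1F Fq d (S₁ ∪ S₂) (r + s)) ∈
      spanTwo Fq (S₁ ∪ S₂) (r + s) := by
  classical
  obtain ⟨r, rfl⟩ := Nat.exists_eq_add_of_le' hr
  obtain ⟨s, rfl⟩ := Nat.exists_eq_add_of_le' hs
  have key : (fun d => S1F Fq d S₁ (r + 1) * S1F Fq d S₂ (s + 1) -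
      S1F Fq d (S₁ ∪ S₂) (r + 1 + (s + 1))) =
      pairSum Fq S₁ S₂ r (s + 1) 1 - pairSum Fq S₁ S₂ (r + 1) s 1 := by
    funext d
    simp only [pairSum, Pi.sub_apply, S1F, Finset.sum_mul_sum, ← Finset.sum_sub_distrib]
    refine Finset.sum_congr rfl fun c _ => ?_
    have hdiag : (∏ i ∈ S₁ ∪ S₂, tval Fq i (mP Fq d c)) *
        MvPolynomial.C (aK Fq (mP Fq d c) ^ (r + 1 + (s + 1)))⁻¹ =
        ∑ c' : Fin d → Fq, if c' = c then (∏ i ∈ S₁ ∪ S₂, tval Fq i (mP Fq d c)) *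
        MvPolynomial.C (aK Fq (mP Fq d c) ^ (r + 1 + (s + 1)))⁻¹ else 0 := by simp
    rw [hdiag, ← Finset.sum_sub_distrib]
    refine Finset.sum_congr rfl fun c' _ => ?_
    have ha := aK_mP_ne_zero Fq d c
    have hb := aK_mP_ne_zero Fq d c'
    rw [← mul_sub, ← map_sub, mul_mul_mul_comm, ← map_mul]
    split_ifs with hcc
    · subst hcc
      rw [Finset.prod_union h]
      have hexp : r + 1 + (s + 1) = s + 1 + (r + 1) := by ring
      simp [hexp, pow_add]
    · rw [sub_zero]
      congr 2
      have h0 : aK Fq (mP Fq d c) - aK Fq (mP Fq d c') ≠ 0 :=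
        sub_ne_zero.2 fun e => hcc (aK_mP_injective Fq d e).symm
      field_simp
      ring
  rw [key]
  refine Submodule.sub_mem _ ?_ ?_
  · convert pairSum_mem Fq S₁ S₂ h r (s + 1) 1 (by omega) le_rfl using 2
    omega
  · convert pairSum_mem Fq S₁ S₂ h (r + 1) s 1 (by omega) le_rfl using 2
    omega

/-! ### The span of power sums is stable under products -/

/-- The operator sending `f` to `d ↦ ∑_{k<d} f k`. -/
def sumLt : (ℕ → PowRing Fq) →ₗ[Fq] (ℕ → PowRing Fq) where
  toFun f d := ∑ k ∈ Finset.range d, f k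
  map_add' f g := by funext d; simp [Finset.sum_add_distrib]
  map_smul' α f := by funext d; simp [Finset.smul_sum]

lemma SPFlt_nil : SPFlt Fq [] = 1 := rfl

lemma SPFlt_cons (x : Finset ℕ+ × ℕ) (L : List (Finset ℕ+ × ℕ)) :
    SPFlt Fq (x :: L) = sumLt Fq (SPF Fq (x :: L)) := rfl

lemma SPF_cons_eq_mul (x : Finset ℕ+ × ℕ) (L : List (Finset ℕ+ × ℕ)) :
    SPF Fq (x :: L) = (fun d => S1F Fq d x.1 x.2) * SPFlt Fq L :=
  funext (SPF_cons Fq x L)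

lemma SPF_mem_spanS {B : List (Finset ℕ+ × ℕ)} {Sg : Finset ℕ+} {w : ℕ} (h : IsCompF B Sg w) :
    SPF Fq B ∈ spanS Fq Sg w := Submodule.subset_span ⟨B, h, rfl⟩

lemma SPFlt_mem_spanLt {B : List (Finset ℕ+ × ℕ)} {Sg : Finset ℕ+} {w : ℕ}
    (h : IsCompF B Sg w) : SPFlt Fq B ∈ spanLt Fq Sg w := Submodule.subset_span ⟨B, h, rfl⟩

lemma isCompF_singleton (Sg : Finset ℕ+) {s : ℕ} (hs : 1 ≤ s) : IsCompF [(Sg, s)] Sg s := by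
  simpa using isCompF_nil.cons (Finset.disjoint_empty_right Sg) hs

lemma mul_mem_of_mem_span {A : Type*} [CommRing A] [Algebra Fq A] {t : Set A}
    {P : Submodule Fq A} (f : A) (h : ∀ y ∈ t, f * y ∈ P) {y : A}
    (hy : y ∈ Submodule.span Fq t) : f * y ∈ P := by
  have : Submodule.span Fq t ≤ P.comap (LinearMap.mulLeft Fq f) := Submodule.span_le.2 h
  exact this hy

lemma sumLt_mem_spanLt {Sg : Finset ℕ+} {w : ℕ} (hw : 1 ≤ w) {f : ℕ → PowRing Fq}
    (hf : f ∈ spanS Fq Sg w) : sumLt Fq f ∈ spanLt Fq Sg w := by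
  have : spanS Fq Sg w ≤ (spanLt Fq Sg w).comap (sumLt Fq) := by
    refine Submodule.span_le.2 ?_
    rintro _ ⟨B, hB, rfl⟩
    rcases B with _ | ⟨x, L⟩
    · have := (isCompF_nil_iff.1 hB).2
      omega
    · exact SPFlt_mem_spanLt Fq hB
  exact this hf

lemma S1F_mul_mem_spanS {S₁ S₂ : Finset ℕ+} {s w : ℕ} (hd : Disjoint S₁ S₂) (hs : 1 ≤ s)
    {u : ℕ → PowRing Fq} (hu : u ∈ spanLt Fq S₂ w) :
    (fun d => S1F Fq d S₁ s) * u ∈ spanS Fq (S₁ ∪ S₂) (s + w) := by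
  refine mul_mem_of_mem_span Fq _ ?_ hu
  rintro _ ⟨B, hB, rfl⟩
  rw [← SPF_cons_eq_mul Fq (S₁, s) B]
  exact SPF_mem_spanS Fq (hB.cons hd hs)

/-- Stability of the spans `spanLt` under products, in total weight less than `n`. -/
def MulStableBelow (n : ℕ) : Prop :=
  ∀ (S₁ S₂ : Finset ℕ+) (w₁ w₂ : ℕ), w₁ + w₂ < n → Disjoint S₁ S₂ →
    ∀ u ∈ spanLt Fq S₁ w₁, ∀ v ∈ spanLt Fq S₂ w₂, u * v ∈ spanLt Fq (S₁ ∪ S₂) (w₁ + w₂)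

lemma spanTwo_mul_mem {S S' : Finset ℕ+} {w w' : ℕ} (ih : MulStableBelow Fq (w + w'))
    (hd : Disjoint S S') {e v : ℕ → PowRing Fq} (he : e ∈ spanTwo Fq S w)
    (hv : v ∈ spanLt Fq S' w') : e * v ∈ spanS Fq (S ∪ S') (w + w') := by
  rw [mul_comm]
  refine mul_mem_of_mem_span Fq _ ?_ he
  rintro _ ⟨J, I, i, j, hi, hj, rfl, hJI, rfl, rfl⟩
  rw [Finset.disjoint_union_left] at hd
  have h1 := ih I S' j w' (by omega) hd.2 _ (SPFlt_mem_spanLt Fq (isCompF_singleton I hj)) v hv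
  have h2 := S1F_mul_mem_spanS Fq (S₁ := J) (Finset.disjoint_union_right.2 ⟨hJI, hd.1⟩) hi h1
  rw [← Finset.union_assoc, ← add_assoc] at h2
  rw [mul_comm]
  exact (mul_assoc (fun d => S1F Fq d J i) (SPFlt Fq [(I, j)]) v).symm ▸ h2

lemma sumLt_mul_sumLt (f g : ℕ → PowRing Fq) :
    sumLt Fq f * sumLt Fq g =
      sumLt Fq (f * sumLt Fq g) + sumLt Fq (g * sumLt Fq f) + sumLt Fq (f * g) := by
  funext d
  simp only [sumLt, LinearMap.coe_mk, AddHom.coe_mk, Pi.mul_apply, Pi.add_apply]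
  induction d with
  | zero => simp
  | succ d ih =>
    simp only [Finset.sum_range_succ] at ih ⊢
    linear_combination ih

lemma mulStableBelow (n : ℕ) : MulStableBelow Fq n := by
  induction n with
  | zero => intro _ _ _ _ h; omega
  | succ n ih =>
    intro S₁ S₂ w₁ w₂ hn hd u hu v hv
    refine mul_mem_of_mem_span Fq _ ?_ hv
    rintro _ ⟨M, hM, rfl⟩
    rw [mul_comm]
    refine mul_mem_of_mem_span Fq _ ?_ hu
    rintro _ ⟨L, hL, rfl⟩
    rw [mul_comm]
    rcases L with _ | ⟨x, L⟩
    · obtain ⟨rfl, rfl⟩ := isCompF_nil_iff.1 hL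
      rw [SPFlt_nil, one_mul, Finset.empty_union, zero_add]
      exact SPFlt_mem_spanLt Fq hM
    rcases M with _ | ⟨y, M⟩
    · obtain ⟨rfl, rfl⟩ := isCompF_nil_iff.1 hM
      rw [SPFlt_nil, mul_one, Finset.union_empty, add_zero]
      exact SPFlt_mem_spanLt Fq hL
    have hxL := SPFlt_mem_spanLt Fq hL
    have hyM := SPFlt_mem_spanLt Fq hM
    obtain ⟨S₁', w₁', hL', hxd, hx, rfl, rfl⟩ := IsCompF.of_cons hL
    obtain ⟨S₂', w₂', hM', hyd, hy, rfl, rfl⟩ := IsCompF.of_cons hM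
    have hd' := hd
    rw [Finset.disjoint_union_left, Finset.disjoint_union_right, Finset.disjoint_union_right] at hd'
    obtain ⟨⟨hxy, hxS⟩, hyS, hSS⟩ := hd'
    have hL'' := SPFlt_mem_spanLt Fq hL'
    have hM'' := SPFlt_mem_spanLt Fq hM'
    rw [SPFlt_cons, SPFlt_cons, sumLt_mul_sumLt, ← SPFlt_cons, ← SPFlt_cons]
    refine Submodule.add_mem _ (Submodule.add_mem _ ?_ ?_) ?_
    · refine sumLt_mem_spanLt Fq (by omega) ?_
      rw [SPF_cons_eq_mul, mul_assoc, Finset.union_assoc, add_assoc]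
      exact S1F_mul_mem_spanS Fq
        (Finset.disjoint_union_right.2 ⟨hxd, Finset.disjoint_union_right.2 ⟨hxy, hxS⟩⟩) hx
        (ih _ _ _ _ (by omega) (Finset.disjoint_union_right.2 ⟨hyS, hSS⟩) _ hL'' _ hyM)
    · refine sumLt_mem_spanLt Fq (by omega) ?_
      rw [SPF_cons_eq_mul, mul_assoc, Finset.union_comm, Finset.union_assoc, add_comm, add_assoc]
      exact S1F_mul_mem_spanS Fq
        (Finset.disjoint_union_right.2 ⟨hyd, Finset.disjoint_union_right.2 ⟨hxy.symm, hyS.symm⟩⟩)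
        hy (ih _ _ _ _ (by omega) (Finset.disjoint_union_right.2 ⟨hxS.symm, hSS.symm⟩) _ hM'' _ hxL)
    · refine sumLt_mem_spanLt Fq (by omega) ?_
      have hLM := ih _ _ _ _ (by omega) hSS _ hL'' _ hM''
      have hdisj : Disjoint (x.1 ∪ y.1) (S₁' ∪ S₂') := by
        simp only [Finset.disjoint_union_left, Finset.disjoint_union_right]
        exact ⟨⟨hxd, hyS.symm⟩, hxS, hyd⟩
      have h1 := S1F_mul_mem_spanS Fq hdisj (s := x.2 + y.2) (by omega) hLM
      have ih' : MulStableBelow Fq (x.2 + y.2 + (w₁' + w₂')) := fun a b c d h =>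
        ih a b c d (by omega)
      have h2 := spanTwo_mul_mem Fq ih' hdisj (S1F_mul_S1F Fq x.1 y.1 hxy x.2 y.2 hx hy) hLM
      rw [Finset.union_union_union_comm, add_add_add_comm]
      convert Submodule.add_mem _ h1 h2 using 1
      rw [SPF_cons_eq_mul, SPF_cons_eq_mul]
      funext d
      simp only [Pi.mul_apply, Pi.add_apply]
      ring

lemma spanS_mul_mem {S₁ S₂ : Finset ℕ+} {w₁ w₂ : ℕ} (hw : 1 ≤ w₁) (hd : Disjoint S₁ S₂)
    {f u : ℕ → PowRing Fq} (hf : f ∈ spanS Fq S₁ w₁) (hu : u ∈ spanLt Fq S₂ w₂) :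
    f * u ∈ spanS Fq (S₁ ∪ S₂) (w₁ + w₂) := by
  rw [mul_comm]
  refine mul_mem_of_mem_span Fq _ ?_ hf
  rintro _ ⟨B, hB, rfl⟩
  rcases B with _ | ⟨x, L⟩
  · have := (isCompF_nil_iff.1 hB).2
    omega
  obtain ⟨S', w', hL, hxd, hx, rfl, rfl⟩ := IsCompF.of_cons hB
  rw [Finset.disjoint_union_left] at hd
  rw [mul_comm, SPF_cons_eq_mul, mul_assoc, Finset.union_assoc, add_assoc]
  exact S1F_mul_mem_spanS Fq (Finset.disjoint_union_right.2 ⟨hxd, hd.1⟩) hx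
    (mulStableBelow Fq _ _ _ _ _ (Nat.lt_succ_self _) hd.2 _ (SPFlt_mem_spanLt Fq hL) _ hu)

/-! ### The depth-one power sum of exponent one -/

/-- Polynomial functions on `Fq ^ d` of degree at most `N` with values in an `Fq`-algebra. -/
def IsPolyFun {R : Type*} [CommRing R] [Algebra Fq R] (d N : ℕ) (F : (Fin d → Fq) → R) : Prop :=
  ∃ f : MvPolynomial (Fin d) R, f.totalDegree ≤ N ∧
    ∀ c, F c = MvPolynomial.eval (fun i => algebraMap Fq R (c i)) f

section PolyFun

variable {Fq} {R : Type*} [CommRing R] [Algebra Fq R] {d : ℕ}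

lemma IsPolyFun.mul {N M : ℕ} {F G : (Fin d → Fq) → R} (hF : IsPolyFun Fq d N F)
    (hG : IsPolyFun Fq d M G) : IsPolyFun Fq d (N + M) fun c => F c * G c := by
  obtain ⟨f, hf, hf'⟩ := hF
  obtain ⟨g, hg, hg'⟩ := hG
  exact ⟨f * g, (MvPolynomial.totalDegree_mul f g).trans (add_le_add hf hg),
    fun c => by simp [hf', hg']⟩

lemma isPolyFun_one : IsPolyFun Fq d 0 fun _ => (1 : R) := ⟨1, by simp, by simp⟩

lemma IsPolyFun.pow {N : ℕ} {F : (Fin d → Fq) → R} (hF : IsPolyFun Fq d N F) (n : ℕ) :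
    IsPolyFun Fq d (n * N) fun c => F c ^ n := by
  induction n with
  | zero => simpa using isPolyFun_one
  | succ n ih => simpa [pow_succ, Nat.succ_mul] using ih.mul hF

lemma isPolyFun_prod {ι : Type*} (s : Finset ι) {F : ι → (Fin d → Fq) → R}
    (hF : ∀ i ∈ s, IsPolyFun Fq d 1 (F i)) : IsPolyFun Fq d s.card fun c => ∏ i ∈ s, F i c := by
  classical
  induction s using Finset.induction_on with
  | empty => simpa using isPolyFun_one
  | insert i s hi ih =>
    simp only [Finset.prod_insert hi, Finset.card_insert_of_notMem hi, add_comm s.card]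
    exact (hF i (Finset.mem_insert_self i s)).mul
      (ih fun k hk => hF k (Finset.mem_insert_of_mem hk))

lemma isPolyFun_aeval_mP (x : R) : IsPolyFun Fq d 1 fun c => Polynomial.aeval x (mP Fq d c) := by
  refine ⟨MvPolynomial.C (x ^ d) +
    ∑ i : Fin d, MvPolynomial.X i * MvPolynomial.C (x ^ (i : ℕ)), ?_, ?_⟩
  · refine (MvPolynomial.totalDegree_add _ _).trans (max_le ?_ ?_)
    · rw [MvPolynomial.totalDegree_C]
      exact zero_le_one
    refine MvPolynomial.totalDegree_finsetSum_le fun i _ => ?_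
    refine (MvPolynomial.totalDegree_mul _ _).trans ?_
    rw [MvPolynomial.totalDegree_C, add_zero]
    exact (MvPolynomial.totalDegree_monomial_le _ _).trans (by simp)
  · intro c
    simp [mP]

lemma IsPolyFun.sum_eq_zero {N : ℕ} {F : (Fin d → Fq) → R} (hF : IsPolyFun Fq d N F)
    (hN : N < (q Fq - 1) * d) : ∑ c, F c = 0 := by
  obtain ⟨f, hf, hf'⟩ := hF
  simp_rw [hf', MvPolynomial.eval_eq']
  rw [Finset.sum_comm]
  refine Finset.sum_eq_zero fun e he => ?_
  have h0 : ∑ c : Fin d → Fq, ∏ i, c i ^ e i = 0 := by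
    have := MvPolynomial.sum_eval_eq_zero (MvPolynomial.monomial e (1 : Fq)) (by
      rw [MvPolynomial.totalDegree_monomial _ one_ne_zero, Fintype.card_fin]
      exact ((MvPolynomial.le_totalDegree he).trans hf).trans_lt hN)
    simpa [MvPolynomial.eval_monomial, Finsupp.prod_fintype] using this
  rw [← Finset.mul_sum]
  have h1 := congrArg (algebraMap Fq R) h0
  simp only [map_sum, map_prod, map_pow, map_zero] at h1
  rw [h1, mul_zero]

end PolyFun

lemma aeval_pow_card_pow {R : Type*} [CommRing R] [Algebra Fq R] (x : R) (a : Polynomial Fq)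
    (m : ℕ) : Polynomial.aeval (x ^ q Fq ^ m) a = Polynomial.aeval x a ^ q Fq ^ m := by
  induction m generalizing x with
  | zero => simp
  | succ m ih =>
    rw [pow_succ', pow_mul, ih, pow_mul, ← map_pow (Polynomial.aeval x), ← FiniteField.expand_card,
      Polynomial.expand_aeval]

lemma aK_eq_aeval (a : Polynomial Fq) : aK Fq a = Polynomial.aeval (th Fq) a := by
  rw [th, Polynomial.aeval_algebraMap_apply, Polynomial.aeval_X_left_apply, aK]

lemma tval_eq_aeval (i : ℕ+) (a : Polynomial Fq) :
    tval Fq i a = Polynomial.aeval (MvPolynomial.X i : PowRing Fq) a := rfl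

lemma C_aK_eq_aeval (a : Polynomial Fq) :
    (MvPolynomial.C (aK Fq a) : PowRing Fq) = Polynomial.aeval (MvPolynomial.C (th Fq)) a := by
  rw [aK_eq_aeval, ← MvPolynomial.algebraMap_eq, Polynomial.aeval_algebraMap_apply]

lemma isPolyFun_pow_card_pow_sub_one (d m : ℕ) :
    IsPolyFun Fq d (m * (q Fq - 1))
      fun c => (MvPolynomial.C (aK Fq (mP Fq d c)) : PowRing Fq) ^ (q Fq ^ m - 1) := by
  induction m with
  | zero => simpa using isPolyFun_one
  | succ m ih =>
    have hq : 1 ≤ q Fq := Fintype.card_pos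
    have hqm : 1 ≤ q Fq ^ m := Nat.one_le_pow _ _ hq
    have hexp : q Fq ^ (m + 1) - 1 = (q Fq ^ m - 1) + q Fq ^ m * (q Fq - 1) := by
      rw [pow_succ, Nat.mul_sub, mul_one]
      have := Nat.le_mul_of_pos_right (q Fq ^ m) hq
      omega
    have h := ih.mul ((isPolyFun_aeval_mP (d := d)
      ((MvPolynomial.C (th Fq) : PowRing Fq) ^ q Fq ^ m)).pow (q Fq - 1))
    simp only [aeval_pow_card_pow, ← C_aK_eq_aeval] at h
    rw [hexp, Nat.succ_mul]
    simpa only [pow_add, pow_mul, mul_one] using h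

lemma sum_pow_mul_prod_tval (d m : ℕ) (hm : m < d) (S : Finset ℕ+) (hS : S.card < q Fq - 1) :
    ∑ c : Fin d → Fq, (MvPolynomial.C (aK Fq (mP Fq d c)) : PowRing Fq) ^ (q Fq ^ m - 1) *
      ∏ i ∈ S, tval Fq i (mP Fq d c) = 0 := by
  refine ((isPolyFun_pow_card_pow_sub_one Fq d m).mul (isPolyFun_prod S fun i _ =>
    (isPolyFun_aeval_mP (MvPolynomial.X i : PowRing Fq)))).sum_eq_zero ?_
  calc m * (q Fq - 1) + S.card < (m + 1) * (q Fq - 1) := by rw [Nat.succ_mul]; omega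
    _ ≤ (q Fq - 1) * d := by rw [mul_comm]; exact Nat.mul_le_mul_left _ hm

lemma th_pow_injective : Function.Injective fun m : ℕ => th Fq ^ q Fq ^ m := by
  intro m n h
  have h' : (X : Polynomial Fq) ^ q Fq ^ m = X ^ q Fq ^ n :=
    RatFunc.algebraMap_injective Fq (by simpa [th] using h)
  have h2 := congrArg Polynomial.natDegree h'
  rw [Polynomial.natDegree_X_pow, Polynomial.natDegree_X_pow] at h2
  exact Nat.pow_right_injective (Fintype.one_lt_card (α := Fq)) h2

/-- Lagrange interpolation of `a(t) - b_d(t)` at the nodes `θ^{q^m}`, `m < d`. -/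
lemma tval_mP_eq (d : ℕ) (i : ℕ+) : ∃ l : ℕ → PowRing Fq, ∀ c : Fin d → Fq,
    tval Fq i (mP Fq d c) = bMv Fq d i + ∑ m ∈ Finset.range d,
      MvPolynomial.C (aK Fq (mP Fq d c)) ^ q Fq ^ m * l m := by
  refine ⟨fun m => Polynomial.aeval (MvPolynomial.X i : PowRing Fq)
    (Lagrange.basis (Finset.range d) (fun m : ℕ => th Fq ^ q Fq ^ m) m), fun c => ?_⟩
  set b : Polynomial (RatFunc Fq) := ∏ m ∈ Finset.range d, (X - C (th Fq ^ q Fq ^ m)) with hb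
  set p := (mP Fq d c).map (algebraMap Fq (RatFunc Fq)) with hp
  have hbm : b.Monic := Polynomial.monic_prod_of_monic _ _ fun m _ => Polynomial.monic_X_sub_C _
  have hpm : p.Monic := (mP_monic Fq d c).map _
  have hbd : b.degree = d := by
    rw [hb, Polynomial.degree_prod, Finset.sum_congr rfl fun m _ => Polynomial.degree_X_sub_C _]
    simp
  have hpd : p.degree = d := by
    rw [hp, Polynomial.degree_map, mP_eq, Polynomial.degree_add_eq_left_of_degree_lt,
      Polynomial.degree_X_pow]
    rw [Polynomial.degree_X_pow]
    exact lowPoly_degree_lt Fq d c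
  have hdeg : (p - b).degree < (Finset.range d).card := by
    rw [Finset.card_range, ← hpd]
    exact Polynomial.degree_sub_lt_left (hpd.trans hbd.symm) hpm.ne_zero
      (hpm.leadingCoeff.trans hbm.leadingCoeff.symm)
  have hint := Lagrange.eq_interpolate_of_eval_eq (fun m => aK Fq (mP Fq d c) ^ q Fq ^ m)
    (th_pow_injective Fq).injOn hdeg (by
      intro m hm
      have h0 : b.eval (th Fq ^ q Fq ^ m) = 0 := by
        rw [hb, Polynomial.eval_prod]
        exact Finset.prod_eq_zero hm (by simp)
      rw [Polynomial.eval_sub, h0, sub_zero, hp, Polynomial.eval_map_algebraMap,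
        aeval_pow_card_pow, aK_eq_aeval])
  have h2 := congrArg (Polynomial.aeval (MvPolynomial.X i : PowRing Fq)) hint
  rw [Lagrange.interpolate_apply, map_sub, hp, Polynomial.aeval_map_algebraMap, ← tval_eq_aeval,
    sub_eq_iff_eq_add'] at h2
  rw [h2]
  simp [bMv, hb, map_prod, MvPolynomial.algebraMap_eq]

lemma S1F_one_eq (d : ℕ) (S : Finset ℕ+) (hS : S.card < q Fq) :
    S1F Fq d S 1 = (∏ i ∈ S, bMv Fq d i) * S1F Fq d ∅ 1 := by
  induction S using Finset.induction_on with
  | empty => simp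
  | insert i S hi ih =>
    rw [Finset.card_insert_of_notMem hi] at hS
    rw [Finset.prod_insert hi, mul_assoc, ← ih (by omega)]
    obtain ⟨l, hl⟩ := tval_mP_eq Fq d i
    have hterm : ∀ c : Fin d → Fq, (∏ k ∈ insert i S, tval Fq k (mP Fq d c)) *
        MvPolynomial.C (aK Fq (mP Fq d c) ^ 1)⁻¹ =
        bMv Fq d i * ((∏ k ∈ S, tval Fq k (mP Fq d c)) *
          MvPolynomial.C (aK Fq (mP Fq d c) ^ 1)⁻¹) +
        ∑ m ∈ Finset.range d, l m * (MvPolynomial.C (aK Fq (mP Fq d c)) ^ (q Fq ^ m - 1) *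
          ∏ k ∈ S, tval Fq k (mP Fq d c)) := by
      intro c
      rw [Finset.prod_insert hi, hl c, add_mul, add_mul, mul_assoc, Finset.sum_mul, Finset.sum_mul]
      congr 1
      refine Finset.sum_congr rfl fun m _ => ?_
      have hqm : q Fq ^ m = (q Fq ^ m - 1) + 1 :=
        (Nat.sub_add_cancel (Nat.one_le_pow _ _ Fintype.card_pos)).symm
      have hinv : (MvPolynomial.C (aK Fq (mP Fq d c)) : PowRing Fq) *
          MvPolynomial.C (aK Fq (mP Fq d c) ^ 1)⁻¹ = 1 := by
        rw [← map_mul, pow_one, mul_inv_cancel₀ (aK_mP_ne_zero Fq d c), map_one]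
      rw [hqm, pow_succ]
      simp only [Nat.add_sub_cancel]
      linear_combination (MvPolynomial.C (aK Fq (mP Fq d c)) ^ (q Fq ^ m - 1) * l m *
        ∏ k ∈ S, tval Fq k (mP Fq d c)) * hinv
    rw [S1F, Finset.sum_congr rfl fun c _ => hterm c, Finset.sum_add_distrib, ← Finset.mul_sum,
      Finset.sum_comm]
    simp_rw [← Finset.mul_sum]
    rw [← S1F, Finset.sum_eq_zero, add_zero]
    intro m hm
    rw [sum_pow_mul_prod_tval Fq d m (Finset.mem_range.1 hm) S (by omega), mul_zero]

/-! ### Dagger power sums -/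

lemma S1D_eq (d : ℕ) (S : Finset ℕ+) (s : ℕ) :
    S1D Fq d S s = (∏ i ∈ S, bMv Fq d i) * S1F Fq d ∅ s := by
  simp [S1D, S1F, Ssc, mul_comm]

lemma S1F_mem_spanS (S : Finset ℕ+) {s : ℕ} (hs : 1 ≤ s) :
    (fun d => S1F Fq d S s) ∈ spanS Fq S s :=
  SPF_mem_spanS Fq (isCompF_singleton S hs)

lemma spanTwo_le_spanS (S : Finset ℕ+) (w : ℕ) : spanTwo Fq S w ≤ spanS Fq S w := by
  refine Submodule.span_le.2 ?_
  rintro _ ⟨J, I, i, j, hi, hj, rfl, hJI, rfl, rfl⟩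
  exact S1F_mul_mem_spanS Fq hJI hi (SPFlt_mem_spanLt Fq (isCompF_singleton I hj))

lemma S1D_mem_spanS (S : Finset ℕ+) (hS : S.card < q Fq) (s : ℕ) (hs : 1 ≤ s) :
    (fun d => S1D Fq d S s) ∈ spanS Fq S s := by
  induction s using Nat.strong_induction_on with
  | _ s ih =>
    obtain ⟨s, rfl⟩ := Nat.exists_eq_add_of_le hs
    rcases Nat.eq_zero_or_pos s with rfl | hs'
    · simp_rw [S1D_eq, add_zero, ← S1F_one_eq Fq _ S hS]
      exact S1F_mem_spanS Fq S le_rfl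
    have h1 := spanTwo_le_spanS Fq _ _
      (S1F_mul_S1F Fq S ∅ (Finset.disjoint_empty_right S) 1 s le_rfl hs')
    have h2 := S1F_mul_S1F Fq ∅ ∅ (Finset.disjoint_empty_right ∅) 1 s le_rfl hs'
    have h3 : (fun d => ∏ i ∈ S, bMv Fq d i) * (fun d => S1F Fq d ∅ 1 * S1F Fq d ∅ s -
        S1F Fq d (∅ ∪ ∅) (1 + s)) ∈ spanS Fq S (1 + s) := by
      refine mul_mem_of_mem_span Fq _ ?_ h2
      rintro _ ⟨J, I, i, j, hi, hj, hij, hJI, hu, rfl⟩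
      rw [Finset.union_self, Finset.union_eq_empty] at hu
      obtain ⟨rfl, rfl⟩ := hu
      have h4 := spanS_mul_mem Fq hi (Finset.disjoint_empty_right S) (ih i (by omega) hi)
        (SPFlt_mem_spanLt Fq (isCompF_singleton ∅ hj))
      rw [Finset.union_empty, hij] at h4
      convert h4 using 1
      funext d
      simp only [Pi.mul_apply, S1D_eq, mul_assoc]
    rw [Finset.union_empty] at h1
    convert Submodule.sub_mem _ (Submodule.add_mem _ h1 (S1F_mem_spanS Fq S hs)) h3 using 1
    funext d
    simp only [Pi.mul_apply, Pi.sub_apply, Pi.add_apply, S1D_eq, S1F_one_eq Fq d S hS,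
      Finset.union_self]
    ring

lemma SPD_mem_spanS (L : List (Finset ℕ+ × ℕ)) (S : Finset ℕ+) (w : ℕ) (hL : IsCompF L S w)
    (hS : S.card < q Fq) : SPD Fq L ∈ spanS Fq S w := by
  induction L generalizing S w with
  | nil => exact SPF_mem_spanS Fq hL
  | cons x L ih =>
    obtain ⟨S', w', hL', hxd, hx, rfl, rfl⟩ := IsCompF.of_cons hL
    have hx1 := S1D_mem_spanS Fq x.1
      ((Finset.card_le_card Finset.subset_union_left).trans_lt hS) x.2 hx
    have hL1 := ih S' w' hL' ((Finset.card_le_card Finset.subset_union_right).trans_lt hS)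
    rcases L with _ | ⟨y, L⟩
    · obtain ⟨rfl, rfl⟩ := isCompF_nil_iff.1 hL'
      rw [Finset.union_empty, add_zero]
      exact hx1
    · obtain ⟨_, _, _, _, hy, _, rfl⟩ := IsCompF.of_cons hL'
      exact spanS_mul_mem Fq hx hxd hx1 (sumLt_mem_spanLt Fq (by omega) hL1)

theorem statement15 (Sg : Finset ℕ+) (hSg : Sg.card < q Fq) (w : ℕ) (hw : 1 ≤ w)
    (A : List (Finset ℕ+ × ℕ)) (hA : IsCompF A Sg w) :
    ∃ (m : ℕ) (α : Fin m → Fq) (Bs : Fin m → List (Finset ℕ+ × ℕ)),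
      (∀ i, IsCompF (Bs i) Sg w) ∧
      ∀ d : ℕ, SPD Fq A d = ∑ i, MvPolynomial.C (FqK Fq (α i)) * SPF Fq (Bs i) d := by
  obtain ⟨m, α, g, hg⟩ := (Submodule.mem_span_set').1 (SPD_mem_spanS Fq A Sg w hA hSg)
  choose B hB hBg using fun i => (g i).2
  refine ⟨m, α, B, hB, fun d => ?_⟩
  have h := congrFun hg d
  simp only [Finset.sum_apply, Pi.smul_apply, ← hBg, smul_powRing] at h
  exact h.symm

end
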